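/- Let k, n be positive integers with n < k, and let p₀,…,p_k ∈ ℝ^{1,n} be (k+1) points such that dim V(p₀,…,pₙ) = dim V(p₀,…,p_k) = n. Then the Lorentzian distance-squared mapping L_{(p₀,…,p_k)} : ℝ^{1,n} → ℝ^{k+1} is A-equivalent to the mapping (x₀,…,xₙ) ↦ (x₁,…,xₙ, x₀x₁, 0,…,0) if and only if the recognition subspace V(p₀,…,p_k) is light-like. -/

import Mathlib

open scoped BigOperators

noncomputable section

/-- The Lorentzian inner product on `ℝ^{1,n}`, modeled as `Fin (n+1) → ℝ`:
`⟨x,y⟩ = -x₀y₀ + x₁y₁ + ⋯ + xₙyₙ`. -/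
def lorIP {n : ℕ} (x y : Fin (n + 1) → ℝ) : ℝ :=
  (∑ i, x i * y i) - 2 * (x 0 * y 0)

/-- The Euclidean inner product on `Fin m → ℝ`. -/
def eucIP {m : ℕ} (x y : Fin m → ℝ) : ℝ := ∑ i, x i * y i

/-- The Lorentzian distance-squared mapping determined by the points `p 0, …, p (m-1)`. -/
def LorDSM {n m : ℕ} (p : Fin m → Fin (n + 1) → ℝ) :
    (Fin (n + 1) → ℝ) → (Fin m → ℝ) :=
  fun x i => lorIP (x - p i) (x - p i)

/-- The Euclidean distance-squared mapping determined by the points `p 0, …, p (m-1)`. -/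
def EucDSM {n m : ℕ} (p : Fin m → Fin (n + 1) → ℝ) :
    (Fin (n + 1) → ℝ) → (Fin m → ℝ) :=
  fun x i => eucIP (x - p i) (x - p i)

/-- The recognition subspace `V(p₀, …, p_k)`: the span of the vectors `p i - p 0`. -/
def recSub {n k : ℕ} (p : Fin (k + 1) → Fin (n + 1) → ℝ) :
    Submodule ℝ (Fin (n + 1) → ℝ) :=
  Submodule.span ℝ (Set.range fun i => p i - p 0)

/-- The partial recognition subspace `V(p₀, …, p_j)`: the span of `p i - p 0` for `i ≤ j`. -/
def recSubUpTo {n k : ℕ} (p : Fin (k + 1) → Fin (n + 1) → ℝ) (j : ℕ) :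
    Submodule ℝ (Fin (n + 1) → ℝ) :=
  Submodule.span ℝ {v | ∃ i : Fin (k + 1), (i : ℕ) ≤ j ∧ v = p i - p 0}

/-- A subspace is time-like iff it contains a vector of negative Lorentzian square. -/
def LTimeLike {n : ℕ} (V : Submodule ℝ (Fin (n + 1) → ℝ)) : Prop :=
  ∃ v ∈ V, lorIP v v < 0

/-- A subspace is space-like iff every nonzero vector in it has positive Lorentzian square. -/
def LSpaceLike {n : ℕ} (V : Submodule ℝ (Fin (n + 1) → ℝ)) : Prop :=
  ∀ v ∈ V, v ≠ 0 → 0 < lorIP v v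

/-- A subspace is light-like iff it is neither time-like nor space-like. -/
def LLightLike {n : ℕ} (V : Submodule ℝ (Fin (n + 1) → ℝ)) : Prop :=
  ¬ LTimeLike V ∧ ¬ LSpaceLike V

/-- `f` and `g` are `𝒜`-equivalent: `g = H ∘ f ∘ h` for `C^∞` diffeomorphisms `h, H`. -/
def AEquiv {a b : ℕ} (f g : (Fin a → ℝ) → (Fin b → ℝ)) : Prop :=
  ∃ (h : (Fin a → ℝ) ≃ (Fin a → ℝ)) (H : (Fin b → ℝ) ≃ (Fin b → ℝ)),
    ContDiff ℝ (⊤ : ℕ∞) ⇑h ∧ ContDiff ℝ (⊤ : ℕ∞) ⇑h.symm ∧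
    ContDiff ℝ (⊤ : ℕ∞) ⇑H ∧ ContDiff ℝ (⊤ : ℕ∞) ⇑H.symm ∧
    g = ⇑H ∘ f ∘ ⇑h

/-- The Lorentzian inner product as a bilinear form. -/
def lorForm (n : ℕ) : LinearMap.BilinForm ℝ (Fin (n + 1) → ℝ) :=
  LinearMap.mk₂ ℝ lorIP
    (fun x y z => by simp only [lorIP, Pi.add_apply, add_mul, Finset.sum_add_distrib]; ring)
    (fun c x y => by
      simp only [lorIP, Pi.smul_apply, smul_eq_mul, mul_assoc, ← Finset.mul_sum]; ring)
    (fun x y z => by simp only [lorIP, Pi.add_apply, mul_add, Finset.sum_add_distrib]; ring)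
    (fun c x y => by
      simp only [lorIP, Pi.smul_apply, smul_eq_mul, mul_left_comm _ c, ← Finset.mul_sum]; ring)

lemma lorForm_apply {n : ℕ} (x y : Fin (n + 1) → ℝ) : lorForm n x y = lorIP x y := rfl

lemma lorIP_comm {n : ℕ} (x y : Fin (n + 1) → ℝ) : lorIP x y = lorIP y x := by
  simp only [lorIP, mul_comm]

lemma lorForm_isRefl (n : ℕ) : (lorForm n).IsRefl := fun x y h => by
  rwa [lorForm_apply, lorIP_comm]

lemma lorIP_add_self {n : ℕ} (x y : Fin (n + 1) → ℝ) :
    lorIP (x + y) (x + y) = lorIP x x + 2 * lorIP x y + lorIP y y := by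
  simp only [← lorForm_apply, map_add, LinearMap.add_apply]
  rw [lorForm_apply y x, lorIP_comm y x, ← lorForm_apply]
  ring

lemma lorIP_eq_succ {n : ℕ} (x y : Fin (n + 1) → ℝ) :
    lorIP x y = ∑ i : Fin n, x i.succ * y i.succ - x 0 * y 0 := by
  rw [lorIP, Fin.sum_univ_succ]
  ring

lemma exists_lorIP_ne_zero {n : ℕ} {w : Fin (n + 1) → ℝ} (hw : w ≠ 0) :
    ∃ v, lorIP v w ≠ 0 := by
  by_contra! h
  apply hw
  have h0 := h (Fin.cons (-w 0) fun i => w i.succ)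
  rw [lorIP_eq_succ] at h0
  simp only [Fin.cons_succ, Fin.cons_zero] at h0
  have h1 : ∑ i, w i * w i = 0 := by
    rw [Fin.sum_univ_succ]
    linarith
  rw [Finset.sum_eq_zero_iff_of_nonneg fun i _ => mul_self_nonneg _] at h1
  ext i
  simpa using h1 i (Finset.mem_univ i)

lemma lorForm_nondegenerate (n : ℕ) : (lorForm n).Nondegenerate := by
  constructor
  · intro x hx
    by_contra h
    obtain ⟨v, hv⟩ := exists_lorIP_ne_zero h
    exact hv (by rw [lorIP_comm]; exact hx v)
  · intro x hx
    by_contra h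
    obtain ⟨v, hv⟩ := exists_lorIP_ne_zero h
    exact hv (hx v)

/-- A nonzero null vector is not orthogonal to any time-like vector. -/
lemma lorIP_self_nonneg_of_ortho_null {n : ℕ} {u v : Fin (n + 1) → ℝ} (hu : u ≠ 0)
    (huu : lorIP u u = 0) (huv : lorIP u v = 0) : 0 ≤ lorIP v v := by
  rw [lorIP_eq_succ] at *
  by_contra! hneg
  have cs := Finset.sum_mul_sq_le_sq_mul_sq Finset.univ
    (fun i : Fin n => u i.succ) (fun i : Fin n => v i.succ)
  simp only [← pow_two] at huu hneg
  have e1 : ∑ i : Fin n, u i.succ ^ 2 = u 0 ^ 2 := by linarith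
  have e2 : ∑ i : Fin n, u i.succ * v i.succ = u 0 * v 0 := by linarith
  rw [e1, e2] at cs
  have hu0 : u 0 = 0 := by
    by_contra h0
    have : 0 < u 0 ^ 2 := by positivity
    nlinarith
  apply hu
  rw [hu0, zero_pow two_ne_zero, Finset.sum_eq_zero_iff_of_nonneg fun i _ => sq_nonneg _] at e1
  ext i
  refine Fin.cases hu0 (fun j => ?_) i
  simpa using e1 j (Finset.mem_univ j)

lemma finrank_lorForm_orthogonal {n : ℕ} {V : Submodule ℝ (Fin (n + 1) → ℝ)}
    (hV : Module.finrank ℝ V = n) : Module.finrank ℝ ((lorForm n).orthogonal V) = 1 := by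
  rw [LinearMap.BilinForm.finrank_orthogonal (lorForm_nondegenerate n), hV, Module.finrank_fin_fun]
  omega

lemma exists_smul_eq_of_mem_orthogonal {n : ℕ} {V : Submodule ℝ (Fin (n + 1) → ℝ)}
    (hV : Module.finrank ℝ V = n) {u v : Fin (n + 1) → ℝ} (hu : u ≠ 0)
    (huV : u ∈ (lorForm n).orthogonal V) (hvV : v ∈ (lorForm n).orthogonal V) :
    ∃ c : ℝ, c • u = v := by
  have h := (finrank_eq_one_iff_of_nonzero'
    (⟨u, huV⟩ : (lorForm n).orthogonal V) (by simpa using hu)).1 (finrank_lorForm_orthogonal hV)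
  obtain ⟨c, hc⟩ := h ⟨v, hvV⟩
  exact ⟨c, congrArg Subtype.val hc⟩

/-- A hyperplane orthogonal to a nonzero null vector is light-like. -/
lemma lLightLike_of_null_mem_orthogonal {n : ℕ} {V : Submodule ℝ (Fin (n + 1) → ℝ)}
    (hV : Module.finrank ℝ V = n) {u : Fin (n + 1) → ℝ} (hu : u ≠ 0)
    (huV : u ∈ (lorForm n).orthogonal V) (huu : lorIP u u = 0) : LLightLike V := by
  constructor
  · rintro ⟨v, hv, hneg⟩
    have huv : lorIP u v = 0 := by
      rw [lorIP_comm]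
      exact LinearMap.BilinForm.mem_orthogonal_iff.1 huV v hv
    exact absurd hneg (not_lt.2 (lorIP_self_nonneg_of_ortho_null hu huu huv))
  · intro hs
    have hmem : u ∈ V := by
      rw [← LinearMap.BilinForm.orthogonal_orthogonal (lorForm_nondegenerate n)
        (lorForm_isRefl n) V, LinearMap.BilinForm.mem_orthogonal_iff]
      intro m hm
      obtain ⟨c, rfl⟩ := exists_smul_eq_of_mem_orthogonal hV hu huV hm
      change lorForm n (c • u) u = 0
      rw [map_smul, LinearMap.smul_apply, lorForm_apply, huu, smul_zero]
    exact (hs u hmem hu).ne' huu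

lemma LLightLike.exists_null_mem_orthogonal {n : ℕ} {V : Submodule ℝ (Fin (n + 1) → ℝ)}
    (h : LLightLike V) :
    ∃ w ∈ V, w ≠ 0 ∧ lorIP w w = 0 ∧ w ∈ (lorForm n).orthogonal V := by
  obtain ⟨ht, hs⟩ := h
  simp only [LTimeLike, not_exists, not_and, not_lt] at ht
  simp only [LSpaceLike, not_forall, not_lt] at hs
  obtain ⟨w, hwV, hw, hle⟩ := hs
  have hww : lorIP w w = 0 := le_antisymm hle (ht w hwV)
  refine ⟨w, hwV, hw, hww, LinearMap.BilinForm.mem_orthogonal_iff.2 fun v hv => ?_⟩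
  change lorIP v w = 0
  by_contra hne
  have key (t : ℝ) : 0 ≤ lorIP v v + 2 * (t * lorIP v w) := by
    have := ht (v + t • w) (V.add_mem hv (V.smul_mem t hwV))
    rw [lorIP_add_self] at this
    simp only [← lorForm_apply, map_smul, LinearMap.smul_apply, smul_eq_mul] at this
    simp only [lorForm_apply, hww] at this
    linarith
  have := key (-(lorIP v v + 1) / lorIP v w)
  rw [div_mul_cancel₀ _ hne] at this
  linarith [ht v hv]

lemma LorDSM_apply {n k : ℕ} (p : Fin (k + 1) → Fin (n + 1) → ℝ) (y : Fin (n + 1) → ℝ)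
    (i : Fin (k + 1)) :
    LorDSM p (p 0 + y) i =
      lorIP y y + 2 * lorIP y (p 0 - p i) + lorIP (p 0 - p i) (p 0 - p i) := by
  rw [LorDSM, ← lorIP_add_self]
  congr 1 <;> abel

lemma mem_orthogonal_recSub {n k : ℕ} {p : Fin (k + 1) → Fin (n + 1) → ℝ}
    {y : Fin (n + 1) → ℝ} :
    y ∈ (lorForm n).orthogonal (recSub p) ↔ ∀ i, lorIP y (p 0 - p i) = 0 := by
  have hneg (i) : lorIP y (p 0 - p i) = -lorForm n y (p i - p 0) := by
    rw [← map_neg, neg_sub, lorForm_apply]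
  rw [LinearMap.BilinForm.mem_orthogonal_iff]
  constructor
  · intro h i
    rw [hneg, neg_eq_zero, lorForm_apply, lorIP_comm]
    exact h _ (Submodule.subset_span ⟨i, rfl⟩)
  · intro h v hv
    have hle : recSub p ≤ LinearMap.ker (lorForm n y) := by
      refine Submodule.span_le.2 ?_
      rintro _ ⟨i, rfl⟩
      simpa only [hneg, neg_eq_zero] using! h i
    change lorIP v y = 0
    rw [lorIP_comm]
    exact hle hv

/-- A linearly independent family extends to a basis indexed by an initial-segment inclusion. -/
lemma exists_basis_castLE {E : Type*} [AddCommGroup E] [Module ℝ E] [FiniteDimensional ℝ E]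
    {m N : ℕ} {v : Fin m → E} (hv : LinearIndependent ℝ v) (hN : Module.finrank ℝ E = N)
    (hm : m ≤ N) :
    ∃ b : Module.Basis (Fin N) ℝ E, ∀ i, b (Fin.castLE hm i) = v i := by
  let b := Module.Basis.sumExtend hv
  have : Finite (Fin m ⊕ Module.Basis.sumExtendIndex hv) := Module.Finite.finite_basis b
  have : Finite (Module.Basis.sumExtendIndex hv) := Finite.sum_right (Fin m)
  have hcard : Nat.card (Module.Basis.sumExtendIndex hv) = N - m := by
    have h := Module.finrank_eq_nat_card_basis b
    rw [Nat.card_sum, Nat.card_fin, hN] at h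
    omega
  let e := Finite.equivFinOfCardEq hcard
  refine ⟨b.reindex (((Equiv.refl _).sumCongr e).trans
    (finSumFinEquiv.trans (finCongr (Nat.add_sub_cancel' hm)))), fun i => ?_⟩
  have : ((((Equiv.refl (Fin m)).sumCongr e).trans
    (finSumFinEquiv.trans (finCongr (Nat.add_sub_cancel' hm))))).symm (Fin.castLE hm i) =
      Sum.inl i := by
    rw [Equiv.symm_apply_eq]
    ext
    simp
  rw [Module.Basis.reindex_apply, this]
  simp only [b, Module.Basis.sumExtend, Module.Basis.reindex_apply,
    Module.Basis.extend_apply_self]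
  rfl

/-- If three distinct points have the same image under the Lorentzian distance-squared mapping,
then the recognition subspace, assumed to be a hyperplane, is light-like. -/
lemma lLightLike_of_LorDSM_eq {n k : ℕ} {p : Fin (k + 1) → Fin (n + 1) → ℝ}
    (hV : Module.finrank ℝ (recSub p) = n) {a b c : Fin (n + 1) → ℝ}
    (hab : a ≠ b) (hac : a ≠ c) (hbc : b ≠ c)
    (h : LorDSM p b = LorDSM p a) (h' : LorDSM p c = LorDSM p a) : LLightLike (recSub p) := by
  have key (x : Fin (n + 1) → ℝ) (hx : LorDSM p x = LorDSM p a) :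
      x - a ∈ (lorForm n).orthogonal (recSub p) ∧
        lorIP (x - a) (x - a) + 2 * lorIP (a - p 0) (x - a) = 0 := by
    have hi (i) : lorIP (x - a) (x - a) + 2 * lorIP (x - a) (a - p i) = 0 := by
      have := congrFun hx i
      simp only [LorDSM] at this
      rw [show x - p i = (x - a) + (a - p i) by abel, lorIP_add_self] at this
      linarith
    refine ⟨mem_orthogonal_recSub.2 fun i => ?_, by rw [lorIP_comm (a - p 0)]; exact hi 0⟩
    have : lorIP (x - a) (p 0 - p i) = lorIP (x - a) (a - p i) - lorIP (x - a) (a - p 0) := by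
      rw [← lorForm_apply, ← lorForm_apply, ← lorForm_apply, ← map_sub]
      congr 1; abel
    linarith [hi i, hi 0]
  obtain ⟨hb, hb'⟩ := key b h
  obtain ⟨hc, hc'⟩ := key c h'
  have hu : b - a ≠ 0 := sub_ne_zero.2 hab.symm
  obtain ⟨r, hr⟩ := exists_smul_eq_of_mem_orthogonal hV hu hb hc
  refine lLightLike_of_null_mem_orthogonal hV hu hb ?_
  have hr0 : r ≠ 0 := by
    rintro rfl
    rw [zero_smul] at hr
    exact hac (sub_eq_zero.1 hr.symm).symm
  have hr1 : r - 1 ≠ 0 := by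
    intro h1
    rw [sub_eq_zero.1 h1, one_smul] at hr
    exact hbc (sub_left_injective hr)
  rw [← hr] at hc'
  simp only [← lorForm_apply, map_smul, LinearMap.smul_apply, smul_eq_mul] at hc'
  simp only [lorForm_apply] at hc'
  have : r * (r - 1) * lorIP (b - a) (b - a) = 0 := by linear_combination hc' - r * hb'
  simpa [hr0, hr1] using this

lemma exists_basis_of_null {m : ℕ} {V : Submodule ℝ (Fin (m + 2) → ℝ)}
    (hV : Module.finrank ℝ V = m + 1) {w : Fin (m + 2) → ℝ} (hwV : w ∈ V) (hw : w ≠ 0)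
    (hwo : w ∈ (lorForm (m + 1)).orthogonal V) :
    ∃ b : Module.Basis (Fin (m + 2)) ℝ (Fin (m + 2) → ℝ), b 0 = w ∧
      ∀ i : Fin (m + 1), lorIP (b i.succ) w = if i = 0 then 1 / 2 else 0 := by
  have hVw : ∀ v ∈ V, lorIP v w = 0 := LinearMap.BilinForm.mem_orthogonal_iff.1 hwo
  obtain ⟨x, hx⟩ : ∃ x, lorIP x w = 1 / 2 := by
    obtain ⟨v, hv⟩ := exists_lorIP_ne_zero hw
    refine ⟨(1 / 2 / lorIP v w) • v, ?_⟩
    rw [← lorForm_apply, map_smul, LinearMap.smul_apply, lorForm_apply, smul_eq_mul,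
      div_mul_cancel₀ _ hv]
  have hli : LinearIndependent ℝ (fun _ : Fin 1 => (⟨w, hwV⟩ : V)) := by
    rw [linearIndependent_unique_iff]
    simpa using hw
  obtain ⟨c, hc⟩ := exists_basis_castLE hli hV (by omega)
  have hc0 : (c 0 : Fin (m + 2) → ℝ) = w := congrArg Subtype.val (hc 0)
  have hli' : LinearIndependent ℝ
      (Fin.cons x (fun i => (c i : Fin (m + 2) → ℝ)) : Fin (m + 2) → Fin (m + 2) → ℝ) := by
    refine linearIndependent_finCons.2
      ⟨c.linearIndependent.map' V.subtype V.ker_subtype, fun hmem => ?_⟩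
    have hxV : x ∈ V := by
      refine Submodule.span_le.2 ?_ hmem
      rintro _ ⟨i, rfl⟩
      exact (c i).2
    rw [hVw x hxV] at hx
    norm_num at hx
  refine ⟨basisOfLinearIndependentOfCardEqFinrank
    (hli'.comp (Equiv.swap 0 1) (Equiv.injective _)) (by simp), ?_, fun i => ?_⟩
  · rw [coe_basisOfLinearIndependentOfCardEqFinrank, Function.comp_apply, Equiv.swap_apply_left,
      ← hc0, ← Fin.succ_zero_eq_one, Fin.cons_succ]
  · rw [coe_basisOfLinearIndependentOfCardEqFinrank, Function.comp_apply]
    refine Fin.cases ?_ (fun j => ?_) i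
    · rw [Fin.succ_zero_eq_one, Equiv.swap_apply_right, Fin.cons_zero, hx, if_pos rfl]
    · rw [Equiv.swap_apply_of_ne_of_ne (Fin.succ_ne_zero _), Fin.cons_succ,
        if_neg (Fin.succ_ne_zero _)]
      · exact hVw _ (c _).2
      · rw [← Fin.succ_zero_eq_one, Ne, Fin.succ_inj]
        exact Fin.succ_ne_zero j

/-- The shear `s ↦ s - q s • e`, for a function `q` invariant under translation along `e`. -/
def shearEquiv {E : Type*} [AddCommGroup E] [Module ℝ E] (q : E → ℝ) (e : E)
    (hq : ∀ s (c : ℝ), q (s + c • e) = q s) : E ≃ E where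
  toFun s := s - q s • e
  invFun s := s + q s • e
  left_inv s := by
    have := hq s (-q s)
    rw [neg_smul, ← sub_eq_add_neg] at this
    simp [this]
  right_inv s := by simp [hq]

/-- The linear part of the Lorentzian distance-squared mapping. -/
def lorLinearPart {n k : ℕ} (p : Fin (k + 1) → Fin (n + 1) → ℝ) :
    (Fin (n + 1) → ℝ) →ₗ[ℝ] (Fin (k + 1) → ℝ) :=
  LinearMap.pi fun i => (2 : ℝ) • (lorForm n).flip (p 0 - p i)

lemma lorLinearPart_apply {n k : ℕ} (p : Fin (k + 1) → Fin (n + 1) → ℝ)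
    (y : Fin (n + 1) → ℝ) (i : Fin (k + 1)) :
    lorLinearPart p y i = 2 * lorIP y (p 0 - p i) := rfl

lemma lorLinearPart_apply_zero {n k : ℕ} (p : Fin (k + 1) → Fin (n + 1) → ℝ)
    (y : Fin (n + 1) → ℝ) : lorLinearPart p y 0 = 0 := by
  rw [lorLinearPart_apply, sub_self, ← lorForm_apply, map_zero, mul_zero]

lemma linearIndependent_snoc_lorLinearPart {n k : ℕ} {p : Fin (k + 1) → Fin (n + 1) → ℝ}
    (hV : Module.finrank ℝ (recSub p) = n)
    (b : Module.Basis (Fin (n + 1)) ℝ (Fin (n + 1) → ℝ))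
    (hb : b 0 ∈ (lorForm n).orthogonal (recSub p)) :
    LinearIndependent ℝ
      (Fin.snoc (fun i : Fin n => lorLinearPart p (b i.succ)) 1 :
        Fin (n + 1) → Fin (k + 1) → ℝ) := by
  refine linearIndependent_finSnoc.2 ⟨?_, fun hmem => ?_⟩
  · rw [Fintype.linearIndependent_iff]
    intro g hg i
    have hmem : ∑ i : Fin n, g i • b i.succ ∈ (lorForm n).orthogonal (recSub p) := by
      refine mem_orthogonal_recSub.2 fun i => ?_
      have := congrFun hg i
      simp only [← map_smul, ← map_sum, lorLinearPart_apply] at this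
      simpa using this
    obtain ⟨c, hc⟩ := exists_smul_eq_of_mem_orthogonal hV (b.ne_zero 0) hb hmem
    have h0 := Fintype.linearIndependent_iff.1 b.linearIndependent
      (Fin.cons (-c) g : Fin (n + 1) → ℝ) (by
        rw [Fin.sum_univ_succ]
        simp only [Fin.cons_zero, Fin.cons_succ, ← hc]
        simp) i.succ
    simpa using h0
  · have hle : Submodule.span ℝ (Set.range fun i : Fin n => lorLinearPart p (b i.succ)) ≤
        LinearMap.ker (LinearMap.proj 0 : (Fin (k + 1) → ℝ) →ₗ[ℝ] ℝ) := by
      refine Submodule.span_le.2 ?_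
      rintro _ ⟨i, rfl⟩
      exact lorLinearPart_apply_zero p _
    have := hle hmem
    simp at this

lemma lorIP_sum_basis {m : ℕ} {b : Fin (m + 2) → Fin (m + 2) → ℝ}
    (hb0 : lorIP (b 0) (b 0) = 0)
    (hb : ∀ i : Fin (m + 1), lorIP (b i.succ) (b 0) = if i = 0 then 1 / 2 else 0)
    (x : Fin (m + 2) → ℝ) :
    lorIP (∑ i, x i • b i) (∑ i, x i • b i) =
      lorIP (∑ i : Fin (m + 1), x i.succ • b i.succ) (∑ i : Fin (m + 1), x i.succ • b i.succ) +
        x 0 * x 1 := by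
  rw [Fin.sum_univ_succ, add_comm (x 0 • b 0), lorIP_add_self]
  generalize hy : ∑ i : Fin (m + 1), x i.succ • b i.succ = y
  have h : lorIP y (b 0) = x 1 * (1 / 2) := by
    rw [← hy, ← lorForm_apply, map_sum, LinearMap.sum_apply]
    simp only [map_smul, LinearMap.smul_apply, lorForm_apply, hb, smul_eq_mul, mul_ite, mul_zero]
    simp
  simp only [← lorForm_apply, map_smul, LinearMap.smul_apply, smul_eq_mul]
  simp only [lorForm_apply, hb0, h]
  ring

lemma contDiff_lorIP_self {n : ℕ} :
    ContDiff ℝ (⊤ : ℕ∞) fun x : Fin (n + 1) → ℝ => lorIP x x := by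
  unfold lorIP
  fun_prop

lemma aEquiv_of_lLightLike {m k : ℕ} (hmk : m + 1 < k) {p : Fin (k + 1) → Fin (m + 2) → ℝ}
    (hV : Module.finrank ℝ (recSub p) = m + 1) (hL : LLightLike (recSub p)) :
    AEquiv (LorDSM p)
        (fun (x : Fin (m + 2) → ℝ) (i : Fin (k + 1)) =>
          if h : (i : ℕ) < m + 1 then x ⟨(i : ℕ) + 1, by omega⟩
          else if (i : ℕ) = m + 1 then x 0 * x 1
          else 0) := by
  obtain ⟨w, hwV, hw, hww, hwo⟩ := hL.exists_null_mem_orthogonal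
  obtain ⟨b, rfl, hb⟩ := exists_basis_of_null hV hwV hw hwo
  have hle : m + 1 + 1 ≤ k + 1 := by omega
  obtain ⟨C, hC⟩ := exists_basis_castLE (linearIndependent_snoc_lorLinearPart hV b hwo)
    (Module.finrank_fin_fun ℝ (n := k + 1)) hle
  let q : (Fin (k + 1) → ℝ) → ℝ := fun s =>
    lorIP (∑ j : Fin (m + 1), s (Fin.castLE hle j.castSucc) • b j.succ)
      (∑ j : Fin (m + 1), s (Fin.castLE hle j.castSucc) • b j.succ)
  have hne (j : Fin (m + 1)) : Fin.castLE hle j.castSucc ≠ Fin.castLE hle (Fin.last _) := by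
    rw [Ne, Fin.castLE_inj]
    exact (Fin.castSucc_lt_last j).ne
  have hqd : ContDiff ℝ (⊤ : ℕ∞) q := by
    refine contDiff_lorIP_self.comp ?_
    fun_prop
  let e : Fin (k + 1) → ℝ := Pi.single (Fin.castLE hle (Fin.last _)) 1
  have hqe (s : Fin (k + 1) → ℝ) (c : ℝ) : q (s + c • e) = q s := by
    simp [q, e, hne, -Fin.castLE_castSucc]
  let K : Fin (k + 1) → ℝ := fun i => lorIP (p 0 - p i) (p 0 - p i)
  let bc := b.equivFun.symm.toContinuousLinearEquiv
  let Cc := C.equivFun.toContinuousLinearEquiv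
  refine ⟨bc.toEquiv.trans (Equiv.addLeft (p 0)),
    (Equiv.subRight K).trans (Cc.toEquiv.trans (shearEquiv q e hqe)), ?_, ?_, ?_, ?_, ?_⟩
  · exact contDiff_const.add bc.contDiff
  · exact bc.symm.contDiff.comp (contDiff_const.add contDiff_id)
  · have : ContDiff ℝ (⊤ : ℕ∞) fun z => Cc (z - K) :=
      Cc.contDiff.comp (contDiff_id.sub contDiff_const)
    exact this.sub ((hqd.comp this).smul contDiff_const)
  · have : ContDiff ℝ (⊤ : ℕ∞) fun z => z + q z • e := contDiff_id.add (hqd.smul contDiff_const)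
    exact (Cc.symm.contDiff.comp this).add contDiff_const
  · funext x
    set y := ∑ i, x i • b i with hy
    have hval : LorDSM p (p 0 + y) - K = lorLinearPart p y + lorIP y y • 1 := by
      ext i
      simp only [Pi.sub_apply, Pi.add_apply, LorDSM_apply, lorLinearPart_apply, K, Pi.smul_apply,
        Pi.one_apply, smul_eq_mul]
      ring
    have hlin : lorLinearPart p y =
        ∑ j : Fin (m + 1), x j.succ • C (Fin.castLE hle j.castSucc) := by
      have h0 : lorLinearPart p (b 0) = 0 := by
        ext i
        rw [lorLinearPart_apply, mem_orthogonal_recSub.1 hwo i, mul_zero, Pi.zero_apply]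
      rw [hy, Fin.sum_univ_succ, map_add, map_smul, h0, smul_zero, zero_add, map_sum]
      simp only [hC, Fin.snoc_castSucc, map_smul]
    have hone : (1 : Fin (k + 1) → ℝ) = C (Fin.castLE hle (Fin.last _)) := by
      rw [hC, Fin.snoc_last]
    obtain ⟨s, hs⟩ : ∃ s, s = C.equivFun (LorDSM p (p 0 + y) - K) := ⟨_, rfl⟩
    have hs' : s = ∑ j : Fin (m + 1), x j.succ • Pi.single (Fin.castLE hle j.castSucc) 1 +
        lorIP y y • e := by
      rw [hs, hval, hlin, hone, map_add, map_sum]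
      simp only [map_smul, e]
      simp only [Module.Basis.equivFun_apply, Module.Basis.repr_self, Finsupp.single_eq_pi_single]
    have hs1 (j : Fin (m + 1)) : s (Fin.castLE hle j.castSucc) = x j.succ := by
      simp [hs', e, hne, Pi.single_apply, -Fin.castLE_castSucc]
    have hs2 : s (Fin.castLE hle (Fin.last _)) = lorIP y y := by
      simp [hs', e, (hne _).symm, -Fin.castLE_castSucc]
    have hs3 (i : Fin (k + 1)) (hi : m + 1 < (i : ℕ)) : s i = 0 := by
      have h1 (j : Fin (m + 1)) : i ≠ Fin.castLE hle j.castSucc := by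
        rintro rfl
        have := j.2
        simp at hi
        omega
      have h2 : i ≠ Fin.castLE hle (Fin.last _) := by
        rintro rfl
        simp at hi
      simp [hs', e, h1, h2, -Fin.castLE_castSucc]
    have hqs : lorIP y y = q s + x 0 * x 1 := by
      simp only [q, hs1]
      exact lorIP_sum_basis hww hb x
    have hgoal : ((Equiv.subRight K).trans (Cc.toEquiv.trans (shearEquiv q e hqe)))
        (LorDSM p ((bc.toEquiv.trans (Equiv.addLeft (p 0))) x)) = s - q s • e := by
      have : (bc.toEquiv.trans (Equiv.addLeft (p 0))) x = p 0 + y := by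
        change p 0 + b.equivFun.symm x = p 0 + y
        rw [Module.Basis.equivFun_symm_apply]
      rw [this, hs]
      rfl
    rw [Function.comp_apply, Function.comp_apply, hgoal]
    funext i
    rcases lt_trichotomy (i : ℕ) (m + 1) with hi | hi | hi
    · obtain ⟨j, rfl⟩ : ∃ j : Fin (m + 1), i = Fin.castLE hle j.castSucc := ⟨⟨i, hi⟩, rfl⟩
      rw [dif_pos hi, Pi.sub_apply, hs1]
      simp only [e, Pi.smul_apply, Pi.single_eq_of_ne (hne j), smul_zero, sub_zero]
      rfl
    · obtain rfl : i = Fin.castLE hle (Fin.last _) := Fin.ext hi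
      rw [dif_neg (by omega), if_pos hi, Pi.sub_apply, hs2, hqs]
      simp [e]
    · have h2 : i ≠ Fin.castLE hle (Fin.last _) := by
        rintro rfl
        simp at hi
      rw [dif_neg (by omega), if_neg (by omega), Pi.sub_apply, hs3 i hi]
      simp [e, h2]

theorem theorem4_2b (k n : ℕ) (hn : 1 ≤ n) (hnk : n < k)
    (p : Fin (k + 1) → Fin (n + 1) → ℝ)
    (h1 : Module.finrank ℝ (recSubUpTo p n) = n)
    (h2 : Module.finrank ℝ (recSub p) = n) :
    AEquiv (LorDSM p)
        (fun (x : Fin (n + 1) → ℝ) (i : Fin (k + 1)) =>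
          if h : (i : ℕ) < n then x ⟨(i : ℕ) + 1, by omega⟩
          else if (i : ℕ) = n then x 0 * x ⟨1, by omega⟩
          else 0)
      ↔ LLightLike (recSub p) := by
  constructor
  · rintro ⟨h, H, -, -, -, -, hg⟩
    have hline (t : ℝ) : LorDSM p (h (Pi.single 0 t)) = LorDSM p (h (Pi.single 0 0)) := by
      apply H.injective
      have key (t : ℝ) := congrFun hg (Pi.single 0 t)
      simp only [Function.comp_apply] at key
      rw [← key t, ← key 0]
      funext i
      have h1 : (⟨1, by omega⟩ : Fin (n + 1)) ≠ 0 :=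
        Fin.ne_of_val_ne one_ne_zero
      have h2 (hi : (i : ℕ) < n) : (⟨(i : ℕ) + 1, by omega⟩ : Fin (n + 1)) ≠ 0 :=
        Fin.ne_of_val_ne (Nat.succ_ne_zero _)
      split_ifs with hi
      · rw [Pi.single_eq_of_ne (h2 hi), Pi.single_eq_of_ne (h2 hi)]
      · rw [Pi.single_eq_of_ne h1, Pi.single_eq_of_ne h1, mul_zero, mul_zero]
      · rfl
    have hinj : Function.Injective fun t : ℝ => h (Pi.single 0 t) :=
      h.injective.comp (Pi.single_injective (M := fun _ : Fin (n + 1) => ℝ) 0)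
    exact lLightLike_of_LorDSM_eq h2 (hinj.ne (zero_ne_one (α := ℝ)))
      (hinj.ne (two_ne_zero (α := ℝ)).symm) (hinj.ne (OfNat.one_ne_ofNat 2)) (hline 1) (hline 2)
  · intro hL
    obtain ⟨m, rfl⟩ := Nat.exists_eq_add_of_le' hn
    exact aEquiv_of_lLightLike hnk h2 hL
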